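/- arXiv:2211.07868 — 2 statements merged into one kernel-verified Lean document; each statement's English description precedes it below -/
import Mathlib

section
/- (Negative slope motif with inflows and equal outflows.) Let k₁, k₂ > 0, k* = k₂/k₁, and ℓ > 0. Let g_a, g_b : ℝ_{≥0} → ℝ_{≥0} with g(t) := g_a(t) + g_b(t) → ∞ as t → ∞. Let a, b : [0,∞) → ℝ_{≥0} be differentiable, satisfying ȧ(t) = k₁·b(t)·(k* − a(t)) + g_a(t) − ℓ·a(t) and ḃ(t) = −k₁·b(t)·(k* − a(t)) + g_b(t) − ℓ·b(t), and assume that if g_b ≡ 0 then b(0) > 0. Define H(t) = e^{−ℓt} ∫₀ᵗ g(s) e^{ℓs} ds. If α := lim_{t→∞} g_a(t)/H(t) exists and is finite, then a(t) → k* + α/k₁ as t → ∞. -/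
open Filter MeasureTheory Topology

/-- Linear decrease comparison. -/
lemma aux_lin (f f' : ℝ → ℝ) (C t₀ t : ℝ) (ht : t₀ ≤ t)
    (hf : ∀ x ≥ t₀, HasDerivAt f (f' x) x) (hC : ∀ x ≥ t₀, f' x ≤ C) :
    f t ≤ f t₀ + C * (t - t₀) := by
  have h := image_le_of_deriv_right_le_deriv_boundary (f := f) (f' := f') (a := t₀) (b := t)
    (B := fun x => f t₀ + C * (x - t₀)) (B' := fun _ => C)
    (fun x hx => (hf x hx.1).continuousAt.continuousWithinAt)
    (fun x hx => (hf x hx.1).hasDerivWithinAt) (by simp) (by fun_prop)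
    (fun x _ => by
      have := (((hasDerivAt_id x).sub_const t₀).const_mul C).const_add (f t₀)
      simpa using this.hasDerivWithinAt)
    (fun x hx => hC x hx.1)
  exact h ⟨ht, le_rfl⟩

/-- Barrier lemma. -/
lemma aux_barrier (f f' : ℝ → ℝ) (c δ : ℝ) (hδ : 0 < δ)
    (hf : ∀ᶠ t in atTop, HasDerivAt f (f' t) t)
    (hc : ∀ᶠ t in atTop, c ≤ f t → f' t ≤ -δ) : ∀ᶠ t in atTop, f t ≤ c := by
  obtain ⟨t₀, h0⟩ := eventually_atTop.1 (hf.and hc)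
  have h1 : ∃ t₁ ≥ t₀, f t₁ ≤ c := by
    by_contra! hcon
    have hlin : ∀ t ≥ t₀, f t ≤ f t₀ + (-δ) * (t - t₀) := fun t ht =>
      aux_lin f f' (-δ) t₀ t ht (fun x hx => (h0 x hx).1)
        (fun x hx => (h0 x hx).2 (hcon x hx).le)
    have hpos : 0 < f t₀ - c := sub_pos.2 (hcon t₀ le_rfl)
    have ht : t₀ + (f t₀ - c) / δ ≥ t₀ := by
      have := div_pos hpos hδ
      linarith
    have h2 := hlin _ ht
    have h3 := hcon _ ht
    have h4 : (-δ) * (t₀ + (f t₀ - c) / δ - t₀) = -(f t₀ - c) := by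
      field_simp
      ring
    linarith
  obtain ⟨t₁, ht₁, hft₁⟩ := h1
  filter_upwards [eventually_ge_atTop t₁] with t ht
  have h := image_le_of_deriv_right_lt_deriv_boundary (f := f) (f' := f') (a := t₁) (b := t)
    (B := fun _ => c) (B' := fun _ => 0)
    (fun x hx => (h0 x (ht₁.trans hx.1)).1.continuousAt.continuousWithinAt)
    (fun x hx => (h0 x (ht₁.trans hx.1)).1.hasDerivWithinAt) hft₁
    (fun x => hasDerivAt_const x c)
    (fun x hx he => by
      have := (h0 x (ht₁.trans hx.1)).2 he.ge
      linarith)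
  exact h ⟨ht, le_rfl⟩

/-- Negative slope motif with inflows and equal outflows: for
`ȧ = k₁b(k* − a) + g_a(t) − ℓa`, `ḃ = −k₁b(k* − a) + g_b(t) − ℓb` with `k* = k₂/k₁`,
`ℓ > 0`, `g := g_a + g_b → ∞`, `b(0) > 0` whenever `g_b ≡ 0`, and
`H(t) = e^{−ℓt}∫₀ᵗ g(s)e^{ℓs} ds`: if `α = lim_{t→∞} g_a(t)/H(t)` exists and is
finite, then `a(t) → k* + α/k₁`. -/
theorem stmt11 (k₁ k₂ ks ℓ : ℝ) (hk₁ : 0 < k₁) (hk₂ : 0 < k₂) (hks : ks = k₂ / k₁)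
    (hℓ : 0 < ℓ)
    (ga gb : ℝ → ℝ)
    (hga0 : ∀ t ≥ (0:ℝ), 0 ≤ ga t) (hgb0 : ∀ t ≥ (0:ℝ), 0 ≤ gb t)
    (hgtop : Tendsto (fun t => ga t + gb t) atTop atTop)
    (a b : ℝ → ℝ)
    (hanneg : ∀ t ≥ (0:ℝ), 0 ≤ a t) (hbnneg : ∀ t ≥ (0:ℝ), 0 ≤ b t)
    (ha : ∀ t ≥ (0:ℝ), HasDerivAt a (k₁ * b t * (ks - a t) + ga t - ℓ * a t) t)
    (hb : ∀ t ≥ (0:ℝ), HasDerivAt b (-(k₁ * b t * (ks - a t)) + gb t - ℓ * b t) t)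
    (hb0 : (∀ t ≥ (0:ℝ), gb t = 0) → 0 < b 0)
    (H : ℝ → ℝ)
    (hH : ∀ t, H t = Real.exp (-ℓ * t) * ∫ s in (0:ℝ)..t, (ga s + gb s) * Real.exp (ℓ * s))
    (α : ℝ) (hα : Tendsto (fun t => ga t / H t) atTop (𝓝 α)) :
    Tendsto a atTop (𝓝 (ks + α / k₁)) := by
  have hks0 : 0 < ks := by rw [hks]; positivity
  have ev0 : ∀ᶠ t : ℝ in atTop, 0 ≤ t := eventually_ge_atTop 0
  -- total mass
  have hT : ∀ t ≥ (0:ℝ), HasDerivAt (fun s => a s + b s)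
      (ga t + gb t - ℓ * (a t + b t)) t := by
    intro t ht
    refine ((ha t ht).add (hb t ht)).congr_deriv ?_
    ring
  have hTtop : Tendsto (fun s => a s + b s) atTop atTop := by
    rw [tendsto_atTop]
    intro M
    have := aux_barrier (fun s => -(a s + b s)) (fun t => -(ga t + gb t - ℓ * (a t + b t)))
      (-M) 1 one_pos (by filter_upwards [ev0] with t ht using (hT t ht).neg)
      (by
        filter_upwards [hgtop.eventually_ge_atTop (ℓ * M + 1)] with t ht hc
        have : ℓ * (a t + b t) ≤ ℓ * M := mul_le_mul_of_nonneg_left (by linarith) hℓ.le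
        linarith)
    filter_upwards [this] with t ht
    linarith
  -- formula for H
  have hHT : ∀ t ≥ (0:ℝ), H t = (a t + b t) - (a 0 + b 0) * Real.exp (-ℓ * t) := by
    intro t ht
    have hd : ∀ x ≥ (0:ℝ), HasDerivAt (fun s => (a s + b s) * Real.exp (ℓ * s))
        ((ga x + gb x) * Real.exp (ℓ * x)) x := by
      intro x hx
      have he : HasDerivAt (fun s => Real.exp (ℓ * s)) (Real.exp (ℓ * x) * ℓ) x := by
        simpa using ((hasDerivAt_id x).const_mul ℓ).exp
      refine ((hT x hx).mul he).congr_deriv ?_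
      ring
    have hint : IntervalIntegrable (fun s => (ga s + gb s) * Real.exp (ℓ * s)) volume 0 t := by
      apply intervalIntegral.intervalIntegrable_deriv_of_nonneg
        (g := fun s => (a s + b s) * Real.exp (ℓ * s))
      · intro x hx
        rw [Set.uIcc_of_le ht] at hx
        exact (hd x hx.1).continuousAt.continuousWithinAt
      · intro x hx
        rw [min_eq_left ht] at hx
        exact hd x hx.1.le
      · intro x hx
        rw [min_eq_left ht] at hx
        have := hga0 x hx.1.le
        have := hgb0 x hx.1.le
        positivity
    rw [hH, intervalIntegral.integral_eq_sub_of_hasDerivAt (fun x hx => by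
      rw [Set.uIcc_of_le ht] at hx
      exact hd x hx.1) hint]
    have : Real.exp (-ℓ * t) * Real.exp (ℓ * t) = 1 := by
      rw [← Real.exp_add]; simp
    simp only [mul_zero, Real.exp_zero, mul_one]
    linear_combination (a t + b t) * this
  have hexp : Tendsto (fun t => Real.exp (-ℓ * t)) atTop (𝓝 0) := by
    apply Real.tendsto_exp_atBot.comp
    exact tendsto_id.const_mul_atTop_of_neg (by linarith)
  have hHdT : Tendsto (fun t => H t / (a t + b t)) atTop (𝓝 1) := by
    have h1 : Tendsto (fun t => 1 - (a 0 + b 0) * Real.exp (-ℓ * t) / (a t + b t)) atTop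
        (𝓝 (1 - 0)) := by
      apply Tendsto.const_sub
      exact (hexp.const_mul (a 0 + b 0)).div_atTop hTtop
    rw [sub_zero] at h1
    refine h1.congr' ?_
    filter_upwards [ev0, hTtop.eventually_gt_atTop 0] with t ht hp
    rw [hHT t ht]
    field_simp
  have hgT : Tendsto (fun t => ga t / (a t + b t)) atTop (𝓝 α) := by
    have h1 := hα.mul hHdT
    rw [mul_one] at h1
    refine h1.congr' ?_
    filter_upwards [hHdT.eventually_ne one_ne_zero] with t ht
    have : H t ≠ 0 := by
      rintro h
      simp [h] at ht
    field_simp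
  have hα0 : 0 ≤ α := by
    refine ge_of_tendsto hgT ?_
    filter_upwards [ev0] with t ht
    exact div_nonneg (hga0 t ht) (add_nonneg (hanneg t ht) (hbnneg t ht))
  have hgU : ∀ ε > 0, ∀ᶠ t in atTop, ga t ≤ (α + ε) * (a t + b t) := by
    intro ε hε
    filter_upwards [hgT.eventually_le_const (show α < α + ε by linarith),
      hTtop.eventually_gt_atTop 0] with t h1 h2
    rwa [div_le_iff₀ h2] at h1
  have hgL : ∀ ε > 0, ∀ᶠ t in atTop, (α - ε) * (a t + b t) ≤ ga t := by
    intro ε hε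
    filter_upwards [hgT.eventually_const_le (show α - ε < α by linarith),
      hTtop.eventually_gt_atTop 0] with t h1 h2
    rwa [le_div_iff₀ h2] at h1
  -- positivity of b
  have hbpos1 : ∃ t₁ ≥ (0:ℝ), 0 < b t₁ := by
    by_contra! hcon
    have hz : ∀ t ≥ (0:ℝ), b t = 0 := fun t ht => le_antisymm (hcon t ht) (hbnneg t ht)
    have hgz : ∀ t ≥ (0:ℝ), gb t = 0 := by
      intro t ht
      have h1 := (hb t ht).hasDerivWithinAt (s := Set.Ici t)
      have h2 : HasDerivWithinAt b 0 (Set.Ici t) t :=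
        (hasDerivWithinAt_const t (Set.Ici t) (0:ℝ)).congr
          (fun x hx => hz x (ht.le.trans hx)) (hz t ht)
      have h3 := (uniqueDiffWithinAt_Ici t).eq_deriv _ h1 h2
      simpa [hz t ht] using h3
    have := hb0 hgz
    have := hcon 0 le_rfl
    linarith
  have hbpos : ∀ᶠ t in atTop, 0 < b t := by
    obtain ⟨t₁, ht₁, hbt₁⟩ := hbpos1
    filter_upwards [eventually_ge_atTop t₁] with t ht
    have h := aux_lin (fun s => -(b s * Real.exp ((k₁ * ks + ℓ) * s)))
      (fun s => -((-(k₁ * b s * (ks - a s)) + gb s - ℓ * b s) * Real.exp ((k₁ * ks + ℓ) * s)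
        + b s * (Real.exp ((k₁ * ks + ℓ) * s) * (k₁ * ks + ℓ)))) 0 t₁ t ht
      (fun x hx => by
        have he : HasDerivAt (fun s => Real.exp ((k₁ * ks + ℓ) * s))
            (Real.exp ((k₁ * ks + ℓ) * x) * (k₁ * ks + ℓ)) x := by
          simpa using ((hasDerivAt_id x).const_mul (k₁ * ks + ℓ)).exp
        exact ((hb x (ht₁.le.trans hx)).mul he).neg)
      (fun x hx => by
        have hx0 : 0 ≤ x := ht₁.le.trans hx
        have h1 := hgb0 x hx0
        have h2 := hanneg x hx0
        have h3 := hbnneg x hx0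
        have h4 : 0 ≤ (k₁ * b x * a x + gb x) * Real.exp ((k₁ * ks + ℓ) * x) := by positivity
        linarith)
    have h5 : 0 < b t₁ * Real.exp ((k₁ * ks + ℓ) * t₁) := by positivity
    have h6 : 0 < b t * Real.exp ((k₁ * ks + ℓ) * t) := by linarith
    exact pos_of_mul_pos_left h6 (Real.exp_pos _).le
  -- b is at least half of the total
  have hhalf : ∀ᶠ t in atTop, a t + b t ≤ 2 * b t := by
    have := aux_barrier (fun s => Real.log (a s + b s) - Real.log (b s))
      (fun t => (ga t + gb t - ℓ * (a t + b t)) / (a t + b t)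
        - (-(k₁ * b t * (ks - a t)) + gb t - ℓ * b t) / b t) (Real.log 2) 1 one_pos
      (by
        filter_upwards [ev0, hbpos, hTtop.eventually_gt_atTop 0] with t ht hbt hTt
        exact ((hT t ht).log hTt.ne').sub ((hb t ht).log hbt.ne'))
      (by
        filter_upwards [ev0, hbpos, hTtop.eventually_gt_atTop 0, hgU 1 one_pos,
          hTtop.eventually_ge_atTop (2 * (ks + (α + 2) / k₁))] with t ht hbt hTt hg hTl hc
        have h1 : 2 * b t ≤ a t + b t := by
          have h2 : Real.log (2 * b t) ≤ Real.log (a t + b t) := by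
            rw [Real.log_mul two_ne_zero hbt.ne']
            linarith
          exact (Real.log_le_log_iff (by positivity) hTt).1 h2
        have h3 : ks + (α + 2) / k₁ ≤ a t := by linarith
        have h4 : α + 2 ≤ k₁ * (a t - ks) := by
          have : (α + 2) / k₁ ≤ a t - ks := by linarith
          rw [div_le_iff₀ hk₁] at this
          linarith
        have h5 : ga t / (a t + b t) ≤ α + 1 := by
          rw [div_le_iff₀ hTt]
          exact hg
        have h6 : gb t / (a t + b t) ≤ gb t / b t :=
          div_le_div_of_nonneg_left (hgb0 t ht) hbt (by linarith [hanneg t ht])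
        have h7 : (ga t + gb t - ℓ * (a t + b t)) / (a t + b t)
          = ga t / (a t + b t) + gb t / (a t + b t) - ℓ := by
          field_simp
        have h8 : (-(k₁ * b t * (ks - a t)) + gb t - ℓ * b t) / b t
          = k₁ * (a t - ks) + gb t / b t - ℓ := by
          field_simp
          ring
        rw [h7, h8]
        linarith)
    filter_upwards [this, hbpos, hTtop.eventually_gt_atTop 0] with t h1 hbt hTt
    have h2 : Real.log (a t + b t) ≤ Real.log (2 * b t) := by
      rw [Real.log_mul two_ne_zero hbt.ne']
      linarith
    exact (Real.log_le_log_iff hTt (by positivity)).1 h2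
  -- a is bounded
  obtain ⟨M, hM0, hM⟩ : ∃ M > 0, ∀ᶠ t in atTop, a t ≤ M := by
    refine ⟨ks + 2 * (α + 2) / k₁, by positivity, ?_⟩
    refine aux_barrier a (fun t => k₁ * b t * (ks - a t) + ga t - ℓ * a t) _ 1 one_pos
      (by filter_upwards [ev0] with t ht using ha t ht) ?_
    filter_upwards [ev0, hhalf, hTtop.eventually_ge_atTop 1, hgU 1 one_pos] with t ht hh hT1 hg hc
    have h4 : 2 * (α + 2) ≤ k₁ * (a t - ks) := by
      have : 2 * (α + 2) / k₁ ≤ a t - ks := by linarith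
      rw [div_le_iff₀ hk₁] at this
      linarith
    have h5 : (a t + b t) / 2 * (2 * (α + 2)) ≤ b t * (k₁ * (a t - ks)) :=
      mul_le_mul (by linarith) h4 (by positivity) (hbnneg t ht)
    have h6 : 0 ≤ ℓ * a t := mul_nonneg hℓ.le (hanneg t ht)
    linarith
  -- conclusion
  have hL : ∀ x, ks + α / k₁ ≤ x ↔ α ≤ k₁ * (x - ks) := by
    intro x
    rw [← le_sub_iff_add_le', div_le_iff₀ hk₁, mul_comm]
  have hkα : k₁ * (α / k₁) = α := by field_simp
  rw [Metric.tendsto_nhds]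
  intro ε hε
  have hup : ∀ᶠ t in atTop, a t ≤ ks + α / k₁ + ε / 2 := by
    refine aux_barrier a (fun t => k₁ * b t * (ks - a t) + ga t - ℓ * a t) _ 1 one_pos
      (by filter_upwards [ev0] with t ht using ha t ht) ?_
    filter_upwards [ev0, hM, hTtop.eventually_ge_atTop ((k₁ * M * M + 1) / (k₁ * ε / 4)),
      hTtop.eventually_gt_atTop 0,
      hgU (k₁ * ε / 4) (by positivity)] with t ht hMt hT1 hTt hg hc
    rw [div_le_iff₀ (by positivity)] at hT1
    have h1 : α + k₁ * ε / 2 ≤ k₁ * (a t - ks) := by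
      have := mul_le_mul_of_nonneg_left hc hk₁.le
      linarith
    have h2 := mul_le_mul_of_nonneg_left h1 hTt.le
    have ha0 := hanneg t ht
    have h3 : k₁ * a t * (a t - ks) ≤ k₁ * M * M := by
      have e1 : a t * a t ≤ M * M := mul_le_mul hMt hMt ha0 hM0.le
      have e2 : 0 ≤ k₁ * a t * ks := by positivity
      have e3 := mul_le_mul_of_nonneg_left e1 hk₁.le
      linarith
    have h6 : 0 ≤ ℓ * a t := mul_nonneg hℓ.le ha0
    linarith
  have hlo : ∀ᶠ t in atTop, -a t ≤ -(ks + α / k₁ - ε / 2) := by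
    refine aux_barrier (fun t => -a t) (fun t => -(k₁ * b t * (ks - a t) + ga t - ℓ * a t)) _ 1
      one_pos (by filter_upwards [ev0] with t ht using (ha t ht).neg) ?_
    filter_upwards [ev0, hM,
      hTtop.eventually_ge_atTop ((k₁ * M * ks + ℓ * M + 1) / (k₁ * ε / 4)),
      hTtop.eventually_gt_atTop 0,
      hgL (k₁ * ε / 4) (by positivity)] with t ht hMt hT1 hTt hg hc
    rw [div_le_iff₀ (by positivity)] at hT1
    have h1 : -α + k₁ * ε / 2 ≤ k₁ * (ks - a t) := by
      have := mul_le_mul_of_nonneg_left hc hk₁.le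
      linarith
    have h2 := mul_le_mul_of_nonneg_left h1 hTt.le
    have ha0 := hanneg t ht
    have h3 : k₁ * a t * (ks - a t) ≤ k₁ * M * ks := by
      have e1 : k₁ * ks * a t ≤ k₁ * ks * M := mul_le_mul_of_nonneg_left hMt (by positivity)
      have e2 : 0 ≤ k₁ * a t * a t := by positivity
      linarith
    have h6 : ℓ * a t ≤ ℓ * M := mul_le_mul_of_nonneg_left hMt hℓ.le
    linarith
  filter_upwards [hup, hlo] with t h1 h2
  rw [Real.dist_eq, abs_lt]
  constructor <;> linarith
end

section
/- (Bifunctional enzyme network with inflows only in X and Y.) Let k₁, k₂, k₃, k₄ > 0 and set k* = k₃/k₄. Let g_x, g_y ≥ 0 be constants with g_x + g_y > 0, and take g_c = g_e = 0. Let x, y, e, c : [0,∞) → ℝ_{≥0} be differentiable and satisfy ẋ = −k₁xe + k₂c + k₄cy + g_x, ẏ = k₃c − k₄cy + g_y, ė = −k₁xe + (k₂+k₃)c, ċ = k₁xe − (k₂+k₃)c, with e(0) + c(0) > 0 and positive initial values. Then y(t) → k* + g_y/(k₄·(e(0)+c(0))) as t → ∞; in particular y(t) → k* if g_y = 0. 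-/
open Filter MeasureTheory Topology

/-- nonnegative derivative on `[T, b]` gives `f T ≤ f b` -/
theorem aux_mono (f f' : ℝ → ℝ) (a b : ℝ) (hab : a ≤ b)
    (hf : ∀ t ≥ a, HasDerivAt f (f' t) t) (h : ∀ t, a < t → t < b → 0 ≤ f' t) : f a ≤ f b := by
  have hm : MonotoneOn f (Set.Icc a b) := by
    apply monotoneOn_of_deriv_nonneg (convex_Icc a b)
    · intro t ht
      exact (hf t ht.1).continuousAt.continuousWithinAt
    · intro t ht
      rw [interior_Icc] at ht
      exact (hf t ht.1.le).differentiableAt.differentiableWithinAt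
    · intro t ht
      rw [interior_Icc] at ht
      rw [(hf t ht.1.le).deriv]
      exact h t ht.1 ht.2
  exact hm ⟨le_rfl, hab⟩ ⟨hab, le_rfl⟩ hab

/-- barrier lemma -/
theorem aux_barrier_s18 (f f' : ℝ → ℝ) (T B : ℝ)
    (hf : ∀ t ≥ T, HasDerivAt f (f' t) t) (h : ∀ t ≥ T, f t < B → 0 ≤ f' t)
    (h0 : B ≤ f T) : ∀ t ≥ T, B ≤ f t := by
  intro t ht
  by_contra! hlt
  have hcont : ContinuousOn f (Set.Icc T t) := fun s hs =>
    (hf s hs.1).continuousAt.continuousWithinAt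
  have hcl : IsCompact (Set.Icc T t ∩ f ⁻¹' Set.Ici B) :=
    (isCompact_Icc).of_isClosed_subset
      (hcont.preimage_isClosed_of_isClosed isClosed_Icc isClosed_Ici) Set.inter_subset_left
  obtain ⟨s, hs, hmax⟩ := hcl.exists_isGreatest ⟨T, ⟨le_rfl, ht⟩, h0⟩
  have hsT : T ≤ s := hs.1.1
  have hfs : B ≤ f s := hs.2
  have := aux_mono f f' s t hs.1.2 (fun r hr => hf r (hsT.trans hr)) (by
    intro r hr1 hr2
    apply h r (hsT.trans hr1.le)
    by_contra! hB
    exact absurd (hmax ⟨⟨hsT.trans hr1.le, hr2.le⟩, hB⟩) (not_le.mpr hr1))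
  linarith

/-- eventual lower bound -/
theorem aux_ev (f f' : ℝ → ℝ) (T B δ : ℝ) (hδ : 0 < δ)
    (hf : ∀ t ≥ T, HasDerivAt f (f' t) t) (h : ∀ t ≥ T, f t < B → δ ≤ f' t) :
    ∃ T' ≥ T, ∀ t ≥ T', B ≤ f t := by
  by_cases hex : ∃ t ≥ T, B ≤ f t
  · obtain ⟨s, hs, hB⟩ := hex
    exact ⟨s, hs, aux_barrier_s18 f f' s B (fun t ht => hf t (hs.le.trans ht))
      (fun t ht hlt => hδ.le.trans (h t (hs.le.trans ht) hlt)) hB⟩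
  · exfalso
    push Not at hex
    set b := T + (B - f T) / δ with hb
    have hp : 0 < (B - f T) / δ := div_pos (by linarith [hex T le_rfl]) hδ
    have hbT : T ≤ b := by linarith
    have := aux_mono (fun t => f t - δ * t) (fun t => f' t - δ * 1) T b hbT
      (fun t ht => (hf t ht).sub ((hasDerivAt_id t).const_mul δ))
      (fun t h1 _ => by linarith [h t h1.le (hex t h1.le)])
    have h2 : δ * ((B - f T) / δ) = B - f T := by field_simp
    have h3 := hex b hbT
    simp only [hb] at this h3
    nlinarith

theorem aux_ev_upper (f f' : ℝ → ℝ) (T B δ : ℝ) (hδ : 0 < δ)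
    (hf : ∀ t ≥ T, HasDerivAt f (f' t) t) (h : ∀ t ≥ T, B < f t → f' t ≤ -δ) :
    ∃ T' ≥ T, ∀ t ≥ T', f t ≤ B := by
  obtain ⟨T', h1, h2⟩ := aux_ev (fun t => - f t) (fun t => - f' t) T (-B) δ hδ
    (fun t ht => (hf t ht).neg) (fun t ht hlt => by
      have := h t ht (by simpa using hlt)
      linarith)
  exact ⟨T', h1, fun t ht => by have := h2 t ht; linarith⟩

/-- Bifunctional enzyme network with inflows only in `X` and `Y`:
for the mass action system `ẋ = −k₁xe + k₂c + k₄cy + g_x`, `ẏ = k₃c − k₄cy + g_y`,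
`ė = −k₁xe + (k₂+k₃)c`, `ċ = k₁xe − (k₂+k₃)c` with constant inflows `g_x, g_y ≥ 0`,
`g_x + g_y > 0`, positive initial values and `e(0)+c(0) > 0`, one has
`y(t) → k₃/k₄ + g_y/(k₄(e(0)+c(0)))`; in particular `y(t) → k₃/k₄` if `g_y = 0`. -/
theorem stmt18 (k₁ k₂ k₃ k₄ ks : ℝ)
    (hk₁ : 0 < k₁) (hk₂ : 0 < k₂) (hk₃ : 0 < k₃) (hk₄ : 0 < k₄)
    (hks : ks = k₃ / k₄)
    (gx gy : ℝ) (hgx : 0 ≤ gx) (hgy : 0 ≤ gy) (hgxy : 0 < gx + gy)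
    (x y e c : ℝ → ℝ)
    (hxn : ∀ t ≥ (0:ℝ), 0 ≤ x t) (hyn : ∀ t ≥ (0:ℝ), 0 ≤ y t)
    (hen : ∀ t ≥ (0:ℝ), 0 ≤ e t) (hcn : ∀ t ≥ (0:ℝ), 0 ≤ c t)
    (hx0 : 0 < x 0) (hy0 : 0 < y 0) (he0 : 0 < e 0) (hc0 : 0 < c 0)
    (hec0 : 0 < e 0 + c 0)
    (hx : ∀ t ≥ (0:ℝ),
      HasDerivAt x (-(k₁ * x t * e t) + k₂ * c t + k₄ * c t * y t + gx) t)
    (hy : ∀ t ≥ (0:ℝ), HasDerivAt y (k₃ * c t - k₄ * c t * y t + gy) t)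
    (he : ∀ t ≥ (0:ℝ), HasDerivAt e (-(k₁ * x t * e t) + (k₂ + k₃) * c t) t)
    (hc : ∀ t ≥ (0:ℝ), HasDerivAt c (k₁ * x t * e t - (k₂ + k₃) * c t) t) :
    Tendsto y atTop (𝓝 (ks + gy / (k₄ * (e 0 + c 0)))) := by
  obtain ⟨M, hM⟩ : ∃ M, M = e 0 + c 0 := ⟨_, rfl⟩
  rw [← hM] at hec0 ⊢
  have hks' : k₃ = k₄ * ks := by rw [hks]; field_simp
  -- conservation
  have hcons : ∀ t ≥ (0:ℝ), e t + c t = M := by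
    intro t ht
    have h1 := aux_mono (fun t => e t + c t) _ 0 t ht
      (fun s hs => (he s hs).add (hc s hs)) (fun s _ _ => by linarith)
    have h2 := aux_mono (fun t => -(e t + c t)) _ 0 t ht
      (fun s hs => ((he s hs).add (hc s hs)).neg) (fun s _ _ => by linarith)
    linarith
  have hcM : ∀ t ≥ (0:ℝ), c t ≤ M := fun t ht => by linarith [hcons t ht, hen t ht]
  have htot : ∀ t ≥ (0:ℝ), x 0 + y 0 + c 0 + (gx + gy) * t ≤ x t + y t + c t := by
    intro t ht
    have h1 := aux_mono (fun t => x t + y t + c t - (gx + gy) * t) _ 0 t ht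
      (fun s hs => (((hx s hs).add (hy s hs)).add (hc s hs)).sub
        ((hasDerivAt_id s).const_mul (gx + gy))) (fun s _ _ => by linarith)
    linarith
  have hw : ∀ t ≥ (0:ℝ), HasDerivAt (fun t => x t + c t)
      (k₄ * c t * (y t - ks) + gx) t := by
    intro t ht
    have h := (hx t ht).add (hc t ht)
    have h2 : -(k₁ * x t * e t) + k₂ * c t + k₄ * c t * y t + gx +
        (k₁ * x t * e t - (k₂ + k₃) * c t) = k₄ * c t * (y t - ks) + gx := by
      rw [hks']; ring
    rw [h2] at h
    exact h
  -- y is eventually bounded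
  have hyb : ∃ Y, ∃ T ≥ (0:ℝ), ∀ t ≥ T, y t ≤ Y := by
    by_cases hex : ∃ t ≥ (0:ℝ), ks ≤ y t
    swap
    · push Not at hex
      exact ⟨ks, 0, le_rfl, fun t ht => (hex t ht).le⟩
    obtain ⟨T, hT, hyT⟩ := hex
    have hyk : ∀ t ≥ T, ks ≤ y t := by
      apply aux_barrier_s18 y _ T ks (fun t ht => hy t (hT.le.trans ht)) _ hyT
      intro t ht hlt
      have := mul_nonneg (mul_nonneg hk₄.le (hcn t (hT.le.trans ht))) (sub_nonneg.mpr hlt.le)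
      rw [hks']; linarith
    have hwT : 0 < x T + c T := by
      have h1 := aux_mono (fun t => (x t + c t) * Real.exp (k₃ * t)) _ 0 T hT
        (fun s hs => (hw s hs).mul (((hasDerivAt_id s).const_mul k₃).exp)) (fun s hs _ => by
          have h1 := mul_nonneg (mul_nonneg hk₄.le (hcn s hs.le)) (hyn s hs.le)
          have h2 := mul_nonneg hk₃.le (hxn s hs.le)
          have h3 : 0 ≤ (k₄ * c s * (y s - ks) + gx) + k₃ * (x s + c s) := by
            have : k₄ * c s * (y s - ks) = k₄ * c s * y s - k₃ * c s := by rw [hks']; ring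
            linarith
          have := mul_nonneg h3 (Real.exp_pos (k₃ * s)).le
          simp only [id]
          linarith)
      simp only [mul_zero, Real.exp_zero, mul_one] at h1
      exact pos_of_mul_pos_left (by linarith) (Real.exp_pos (k₃ * T)).le
    obtain ⟨w, hwd⟩ : ∃ w, w = x T + c T := ⟨_, rfl⟩
    rw [← hwd] at hwT
    have hwl : ∀ t ≥ T, w ≤ x t + c t := by
      intro t ht
      rw [hwd]
      exact aux_mono (fun t => x t + c t) _ T t ht (fun s hs => hw s (hT.le.trans hs))
        (fun s hs _ => by
          have := mul_nonneg (mul_nonneg hk₄.le (hcn s (hT.le.trans hs.le)))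
            (sub_nonneg.mpr (hyk s hs.le))
          linarith)
    have hKpos : 0 < k₂ + k₃ := by linarith
    have hP : 0 < k₁ * w * M := by positivity
    obtain ⟨B, hB⟩ : ∃ B, B = min (min (w/2) (M/2)) (k₁ * w * M / (8 * (k₂ + k₃))) := ⟨_, rfl⟩
    have hB0 : 0 < B := by rw [hB]; positivity
    have hB1 : B ≤ w/2 := by rw [hB]; exact (min_le_left _ _).trans (min_le_left _ _)
    have hB2 : B ≤ M/2 := by rw [hB]; exact (min_le_left _ _).trans (min_le_right _ _)
    have hB3 : (k₂ + k₃) * B ≤ k₁ * w * M / 8 := by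
      have h : B ≤ k₁ * w * M / (8 * (k₂ + k₃)) := by rw [hB]; exact min_le_right _ _
      rw [le_div_iff₀ (by positivity)] at h
      linarith
    obtain ⟨T1, hT1, hcB⟩ := aux_ev c _ T B (k₁ * w * M / 8) (by positivity)
      (fun t ht => hc t (hT.le.trans ht)) (by
        intro t ht hlt
        have ht0 := hT.le.trans ht
        have hx1 : w/2 ≤ x t := by linarith [hwl t ht]
        have he1 : M/2 ≤ e t := by linarith [hcons t ht0]
        have h1 : (w/2) * (M/2) ≤ x t * e t :=
          mul_le_mul hx1 he1 (by positivity) (hxn t ht0)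
        have h2 := mul_le_mul_of_nonneg_left h1 hk₁.le
        have h3 := mul_le_mul_of_nonneg_left hlt.le hKpos.le
        linarith)
    obtain ⟨T2, hT2, hyY⟩ := aux_ev_upper y _ T1 (ks + (gy + 1) / (k₄ * B)) 1 one_pos
      (fun t ht => hy t ((hT.le.trans hT1).trans ht)) (by
        intro t ht hlt
        have h1 : (gy + 1) / (k₄ * B) ≤ y t - ks := by linarith
        rw [div_le_iff₀ (by positivity)] at h1
        have h0 : 0 ≤ y t - ks := sub_nonneg.mpr (hyk t (hT1.le.trans ht))
        have h2 := mul_le_mul_of_nonneg_left (hcB t ht) (mul_nonneg hk₄.le h0)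
        rw [hks']
        linarith)
    exact ⟨_, T2, (hT.le.trans hT1).trans hT2, hyY⟩
  obtain ⟨Y, TY, hTY, hyY⟩ := hyb
  have hKpos : 0 < k₂ + k₃ := by linarith
  have hxX : ∀ X, ∃ T ≥ (0:ℝ), ∀ t ≥ T, X ≤ x t := by
    intro X
    refine ⟨max TY ((X + Y + M) / (gx + gy)), hTY.le.trans (le_max_left _ _), ?_⟩
    intro t ht
    have h1 : TY ≤ t := (le_max_left _ _).trans ht
    have h2 : (X + Y + M) / (gx + gy) ≤ t := (le_max_right _ _).trans ht
    rw [div_le_iff₀ hgxy] at h2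
    have ht0 := hTY.le.trans h1
    linarith [htot t ht0, hyY t h1, hcM t ht0]
  have hcl : ∀ η > 0, ∃ T ≥ (0:ℝ), ∀ t ≥ T, M - η ≤ c t := by
    intro η hη
    obtain ⟨T, hT, hX⟩ := hxX (((k₂ + k₃) * M + 1) / (k₁ * η))
    obtain ⟨T1, hT1, h⟩ := aux_ev c _ T (M - η) 1 one_pos
      (fun t ht => hc t (hT.le.trans ht)) (by
        intro t ht hlt
        have ht0 := hT.le.trans ht
        have h1 := hX t ht
        rw [div_le_iff₀ (by positivity)] at h1
        have he1 : η ≤ e t := by linarith [hcons t ht0]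
        have h2 := mul_le_mul_of_nonneg_left he1 (mul_nonneg hk₁.le (hxn t ht0))
        have h3 := mul_le_mul_of_nonneg_left (hcM t ht0) hKpos.le
        linarith)
    exact ⟨T1, hT.le.trans hT1, h⟩
  obtain ⟨q, hq⟩ : ∃ q, q = gy / (k₄ * M) := ⟨_, rfl⟩
  have hqM : gy = k₄ * M * q := by rw [hq]; field_simp
  have hq0 : 0 ≤ q := by rw [hq]; positivity
  rw [← hq, Metric.tendsto_atTop]
  intro ε' hε'
  obtain ⟨ε, hε, hεε⟩ : ∃ ε, 0 < ε ∧ ε < ε' := ⟨ε'/2, by linarith, by linarith⟩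
  obtain ⟨η, hη⟩ : ∃ η, η = min (M/2) (ε * M / (4 * (q + 1))) := ⟨_, rfl⟩
  have hη0 : 0 < η := by rw [hη]; positivity
  have hη1 : η ≤ M/2 := by rw [hη]; exact min_le_left _ _
  have hη2 : η * q ≤ ε * M / 4 := by
    have h : η ≤ ε * M / (4 * (q + 1)) := by rw [hη]; exact min_le_right _ _
    rw [le_div_iff₀ (by positivity)] at h
    linarith
  obtain ⟨T, hT, hcT⟩ := hcl η hη0
  have hδ : 0 < k₄ * (ε * M / 4) := by positivity
  obtain ⟨T1, hT1, hup⟩ := aux_ev_upper y _ T (ks + q + ε) _ hδ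
    (fun t ht => hy t (hT.le.trans ht)) (by
      intro t ht hlt
      have ht0 := hT.le.trans ht
      have h1 : c t * (q + ε) ≤ c t * (y t - ks) :=
        mul_le_mul_of_nonneg_left (by linarith) (hcn t ht0)
      have h2 : (M - η) * q ≤ c t * q := mul_le_mul_of_nonneg_right (hcT t ht) hq0
      have h3 : (M / 2) * ε ≤ c t * ε :=
        mul_le_mul_of_nonneg_right (by linarith [hcT t ht]) hε.le
      have h4 : M * q - c t * (y t - ks) ≤ -(ε * M / 4) := by linarith
      have := mul_le_mul_of_nonneg_left h4 hk₄.le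
      rw [hks', hqM]
      linarith)
  obtain ⟨T2, hT2, hlo⟩ := aux_ev y _ T (ks + q - ε) _ hδ
    (fun t ht => hy t (hT.le.trans ht)) (by
      intro t ht hlt
      have ht0 := hT.le.trans ht
      have h1 : c t * (y t - ks) ≤ c t * (q - ε) :=
        mul_le_mul_of_nonneg_left (by linarith) (hcn t ht0)
      have h2 : c t * q ≤ M * q := mul_le_mul_of_nonneg_right (hcM t ht0) hq0
      have h3 : (M / 2) * ε ≤ c t * ε :=
        mul_le_mul_of_nonneg_right (by linarith [hcT t ht]) hε.le
      have h5 : 0 < ε * M := by positivity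
      have h4 : ε * M / 4 ≤ M * q - c t * (y t - ks) := by linarith
      have := mul_le_mul_of_nonneg_left h4 hk₄.le
      rw [hks', hqM]
      linarith)
  refine ⟨max T1 T2, fun t ht => ?_⟩
  have h1 := hup t ((le_max_left _ _).trans ht)
  have h2 := hlo t ((le_max_right _ _).trans ht)
  rw [Real.dist_eq, abs_lt]
  constructor <;> linarith
end
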